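/- The single-piece decomposition does not preserve sometimes-termination of the Datalog-first restricted chase: the rule set 𝓡 = {A(x) → ∃y.(R(x,x) ∧ H(x,y)); R(x,y) ∧ S(y,z) → S(x,x); A(x) ∧ S(x,y) → A(y); A(x) → ∃y.R(x,y); R(x,y) → ∃z.S(y,z)} belongs to CT_{df-R}^∃, but sp(𝓡) does not belong to CT_{df-R}^∃. -/

import Mathlib

namespace ExRules

open scoped Classical

noncomputable section

/-- Terms: constants or variables, each indexed by a natural number. -/
inductive Term where
  | const : ℕ → Term
  | var : ℕ → Term
deriving DecidableEq

/-- An atom: a predicate symbol applied to a list of terms (the arity of the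
predicate is the length of the argument list). -/
structure Atom where
  pred : ℕ
  args : List Term
deriving DecidableEq

/-- A factbase is a finite set of atoms. -/
abbrev FactBase := Finset Atom

/-- A substitution: a map on variables (extended by the identity on constants). -/
abbrev Subst := ℕ → Term

def applyTerm (σ : Subst) : Term → Term
  | .const c => .const c
  | .var v => σ v

def Atom.subst (σ : Subst) (a : Atom) : Atom := ⟨a.pred, a.args.map (applyTerm σ)⟩

def Term.vars : Term → Finset ℕ
  | .const _ => ∅
  | .var v => {v}

def Atom.vars (a : Atom) : Finset ℕ := a.args.foldr (fun t s => t.vars ∪ s) ∅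

def FactBase.vars (F : FactBase) : Finset ℕ := F.sup Atom.vars

/-- The variables occurring in a (possibly infinite) set of atoms. -/
def setVars (S : Set Atom) : Set ℕ := {v | ∃ a ∈ S, v ∈ a.vars}

/-- `σ` is a homomorphism from the atom set `S` to the atom set `S'`. -/
def IsHom (σ : Subst) (S S' : Set Atom) : Prop := ∀ a ∈ S, a.subst σ ∈ S'

/-- A retraction is a homomorphism that is the identity on the common variables. -/
def IsRetraction (σ : Subst) (S S' : Set Atom) : Prop :=
  IsHom σ S S' ∧ ∀ v, v ∈ setVars S → v ∈ setVars S' → σ v = Term.var v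

/-- An existential rule `B → ∃z.H` with nonempty body and head.  The frontier and
the existential variables are determined by the variables shared between body and
head. -/
structure Rule where
  body : Finset Atom
  head : Finset Atom
  body_nonempty : body.Nonempty
  head_nonempty : head.Nonempty

instance : DecidableEq Rule := fun R S =>
  decidable_of_iff (R.body = S.body ∧ R.head = S.head) (by
    constructor
    · rintro ⟨h1, h2⟩
      cases R; cases S; simp_all
    · rintro rfl; exact ⟨rfl, rfl⟩)

/-- The frontier of a rule: the variables shared by body and head. -/
def Rule.frontier (R : Rule) : Finset ℕ := FactBase.vars R.body ∩ FactBase.vars R.head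

/-- The existential variables of a rule: head variables not occurring in the body. -/
def Rule.exVars (R : Rule) : Finset ℕ := FactBase.vars R.head \ FactBase.vars R.body

/-- A rule is Datalog if it has no existential variable. -/
def Rule.IsDatalog (R : Rule) : Prop := R.exVars = ∅

/-- A rule has an atomic head if its head is a single atom. -/
def Rule.IsAtomicHead (R : Rule) : Prop := R.head.card = 1

/-- A rule set is a finite set of existential rules. -/
abbrev RuleSet := Finset Rule

instance : Encodable Term :=
  Encodable.ofEquiv (ℕ ⊕ ℕ)
    { toFun := fun t => match t with | .const c => .inl c | .var v => .inr v
      invFun := fun s => match s with | .inl c => .const c | .inr v => .var v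
      left_inv := by intro t; cases t <;> rfl
      right_inv := by intro s; cases s <;> rfl }

instance : Encodable Atom :=
  Encodable.ofEquiv (ℕ × List Term)
    { toFun := fun a => (a.pred, a.args)
      invFun := fun p => ⟨p.1, p.2⟩
      left_inv := fun _ => rfl
      right_inv := fun _ => rfl }

instance : Encodable Rule :=
  Encodable.ofEquiv {p : Finset Atom × Finset Atom // p.1.Nonempty ∧ p.2.Nonempty}
    { toFun := fun R => ⟨(R.body, R.head), R.body_nonempty, R.head_nonempty⟩
      invFun := fun p => ⟨p.1.1, p.1.2, p.2.1, p.2.2⟩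
      left_inv := fun _ => rfl
      right_inv := fun _ => rfl }

/-- A trigger `(R, π)`: a rule together with a substitution. -/
structure Trigger where
  rule : Rule
  map : Subst

/-- The canonical fresh variable `z_t` associated to a trigger `t` and an
existential variable `z`: it is unique for `z` and (the relevant part of) `t`. -/
def Trigger.freshVar (t : Trigger) (z : ℕ) : ℕ :=
  Nat.pair
    (Encodable.encode (t.rule, ((FactBase.vars t.rule.body).sort (· ≤ ·)).map t.map)) z

/-- The extension `π_R` of the substitution of a trigger, mapping each existential
variable `z` to the fresh variable `z_t`. -/
def Trigger.ext (t : Trigger) : Subst := fun v =>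
  if v ∈ t.rule.exVars then Term.var (t.freshVar v) else t.map v

/-- The output of a trigger: `out(t) = π_R(H)`. -/
def Trigger.out (t : Trigger) : Finset Atom := t.rule.head.image (Atom.subst t.ext)

/-- `t` is a trigger on the factbase `F`: its substitution is a homomorphism from
the body of its rule to `F`. -/
def Trigger.IsOn (t : Trigger) (F : FactBase) : Prop := IsHom t.map ↑t.rule.body ↑F

/-- The chase variants: oblivious, semi-oblivious, restricted, equivalent. -/
inductive Variant where
  | O | SO | R | E

/-- Applicability of a trigger on a factbase, for each chase variant. -/
def Applicable : Variant → Trigger → FactBase → Prop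
  | .O, t, F => ¬ t.out ⊆ F
  | .SO, t, F => ∀ t' : Trigger, t'.rule = t.rule →
      (∀ v ∈ t.rule.frontier, t'.map v = t.map v) → ¬ t'.out ⊆ F
  | .R, t, F => ¬ ∃ σ : Subst, IsRetraction σ ↑(F ∪ t.out) ↑F
  | .E, t, F => ¬ ∃ σ : Subst, IsHom σ ↑(F ∪ t.out) ↑F

/-- An atom set `M` satisfies a rule `B → ∃z.H` if every homomorphism from `B`
to `M` extends to a homomorphism mapping `H` into `M`. -/
def SatisfiesRule (M : Set Atom) (R : Rule) : Prop :=
  ∀ σ : Subst, IsHom σ ↑R.body M →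
    ∃ σ' : Subst, (∀ v ∈ FactBase.vars R.body, σ' v = σ v) ∧ IsHom σ' ↑R.head M

/-- A (finite or infinite) derivation from the knowledge base `⟨𝓡, F⟩`:
`len` is the number of triggers (possibly `⊤`), `fb i` is the `i`-th factbase and,
for `i < len`, `tr i` is the trigger producing `fb (i+1)` from `fb i`. -/
structure Derivation (𝓡 : RuleSet) (F : FactBase) where
  len : ℕ∞
  fb : ℕ → FactBase
  tr : ℕ → Trigger
  fb_zero : fb 0 = F
  rule_mem : ∀ i : ℕ, (i : ℕ∞) < len → (tr i).rule ∈ 𝓡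
  trig_on : ∀ i : ℕ, (i : ℕ∞) < len → (tr i).IsOn (fb i)
  trig_new : ∀ i : ℕ, (i : ℕ∞) < len → ¬ (tr i).out ⊆ fb i
  fb_succ : ∀ i : ℕ, (i : ℕ∞) < len → fb (i + 1) = fb i ∪ (tr i).out
  fb_stall : ∀ i : ℕ, ¬ (i : ℕ∞) < len → fb (i + 1) = fb i

namespace Derivation

variable {𝓡 : RuleSet} {F : FactBase}

/-- An `X`-derivation: every applied trigger is `X`-applicable when applied. -/
def IsX (X : Variant) (D : Derivation 𝓡 F) : Prop :=
  ∀ i : ℕ, (i : ℕ∞) < D.len → Applicable X (D.tr i) (D.fb i)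

/-- Datalog-first: a non-Datalog rule is only applied when all Datalog rules of
the rule set are satisfied. -/
def DatalogFirst (D : Derivation 𝓡 F) : Prop :=
  ∀ i : ℕ, (i : ℕ∞) < D.len → ¬ (D.tr i).rule.IsDatalog →
    ∀ R ∈ 𝓡, R.IsDatalog → SatisfiesRule ↑(D.fb i) R

/-- Fairness: every trigger `X`-applicable on some factbase of the derivation is
eventually not `X`-applicable. -/
def Fair (X : Variant) (D : Derivation 𝓡 F) : Prop :=
  ∀ i : ℕ, (i : ℕ∞) ≤ D.len → ∀ t : Trigger, t.rule ∈ 𝓡 → t.IsOn (D.fb i) →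
    Applicable X t (D.fb i) →
    ∃ j : ℕ, i < j ∧ (j : ℕ∞) ≤ D.len ∧ ¬ Applicable X t (D.fb j)

/-- A derivation is finite if its length is not `⊤`. -/
def Finite (D : Derivation 𝓡 F) : Prop := D.len ≠ ⊤

end Derivation

/-- `CT_X^∀` (non-Datalog-first): every fair `X`-derivation from every KB is finite. -/
def CTall (X : Variant) (𝓡 : RuleSet) : Prop :=
  ∀ F : FactBase, ∀ D : Derivation 𝓡 F, D.IsX X → D.Fair X → D.Finite

/-- `CT_X^∃`: some fair `X`-derivation from every KB is finite. -/
def CTex (X : Variant) (𝓡 : RuleSet) : Prop :=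
  ∀ F : FactBase, ∃ D : Derivation 𝓡 F, D.IsX X ∧ D.Fair X ∧ D.Finite

/-- `CT_{df-X}^∀`: every fair Datalog-first `X`-derivation from every KB is finite. -/
def CTallDF (X : Variant) (𝓡 : RuleSet) : Prop :=
  ∀ F : FactBase, ∀ D : Derivation 𝓡 F, D.IsX X → D.DatalogFirst → D.Fair X → D.Finite

/-- `CT_{df-X}^∃`: some fair Datalog-first `X`-derivation from every KB is finite. -/
def CTexDF (X : Variant) (𝓡 : RuleSet) : Prop :=
  ∀ F : FactBase, ∃ D : Derivation 𝓡 F, D.IsX X ∧ D.DatalogFirst ∧ D.Fair X ∧ D.Finite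

/-! ### Single-piece decomposition -/

/-- Adjacency in the piece graph of a rule: two head atoms sharing an existential
variable. -/
def PieceAdj (R : Rule) (a b : Atom) : Prop :=
  a ∈ R.head ∧ b ∈ R.head ∧ (a.vars ∩ b.vars ∩ R.exVars).Nonempty

/-- The piece (connected component of the piece graph) containing a given head atom. -/
def pieceOf (R : Rule) (a : Atom) : Finset Atom :=
  R.head.filter fun b => Relation.ReflTransGen (PieceAdj R) a b

theorem self_mem_pieceOf {R : Rule} {a : Atom} (h : a ∈ R.head) : a ∈ pieceOf R a := by
  rw [pieceOf, Finset.mem_filter]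
  exact ⟨h, Relation.ReflTransGen.refl⟩

/-- The single-piece decomposition of a rule. -/
def Rule.sp (R : Rule) : Finset Rule :=
  R.head.attach.image fun a =>
    ⟨R.body, pieceOf R a.1, R.body_nonempty, ⟨a.1, self_mem_pieceOf a.2⟩⟩

/-- The single-piece decomposition of a rule set. -/
def spSet (𝓡 : RuleSet) : RuleSet := 𝓡.biUnion Rule.sp

/-! ### Atomic decompositions -/

/-- The predicates occurring in a rule set. -/
def RuleSet.predsF (𝓡 : RuleSet) : Finset ℕ :=
  𝓡.sup fun R => (R.body.image Atom.pred) ∪ (R.head.image Atom.pred)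

/-- A fresh predicate `X_R`, unique for `R` and not occurring in `𝓡`. -/
def freshPred (𝓡 : RuleSet) (R : Rule) : ℕ :=
  (RuleSet.predsF 𝓡).sup id + 1 + Encodable.encode R

/-- The atom `X_R(x, z)` over the fresh predicate, whose arguments are the frontier
variables followed by the existential variables of `R`. -/
def xAtom (𝓡 : RuleSet) (R : Rule) : Atom :=
  ⟨freshPred 𝓡 R,
    ((R.frontier.sort (· ≤ ·)).map Term.var) ++ ((R.exVars.sort (· ≤ ·)).map Term.var)⟩

/-- The one-way atomic decomposition of a rule `R = B → ∃z.H` (relative to `𝓡`):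
the rule `B → ∃z.X_R(x,z)` together with a rule `X_R(x,z) → P(t)` for each head atom. -/
def oneAdRule (𝓡 : RuleSet) (R : Rule) : Finset Rule :=
  insert ⟨R.body, {xAtom 𝓡 R}, R.body_nonempty, Finset.singleton_nonempty _⟩
    (R.head.attach.image fun a =>
      ⟨{xAtom 𝓡 R}, {a.1}, Finset.singleton_nonempty _, Finset.singleton_nonempty _⟩)

/-- The one-way atomic decomposition of a rule set. -/
def oneAd (𝓡 : RuleSet) : RuleSet := 𝓡.biUnion (oneAdRule 𝓡)

/-- The two-way atomic decomposition: `2ad(R) = 1ad(R) ∪ {H[x,z] → X_R(x,z)}`. -/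
def twoAd (𝓡 : RuleSet) : RuleSet :=
  oneAd 𝓡 ∪ 𝓡.image fun R =>
    ⟨R.head, {xAtom 𝓡 R}, R.head_nonempty, Finset.singleton_nonempty _⟩

/-! ### Models, entailment, BDDP -/

/-- `M` is a model of the rule set `𝓡`. -/
def IsModelOfRules (𝓡 : RuleSet) (M : Set Atom) : Prop := ∀ R ∈ 𝓡, SatisfiesRule M R

/-- `M` is a model of the knowledge base `⟨𝓡, F⟩`. -/
def IsModelOfKB (𝓡 : RuleSet) (F : FactBase) (M : Set Atom) : Prop :=
  IsModelOfRules 𝓡 M ∧ ∃ σ : Subst, IsHom σ ↑F M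

/-- `M` is a universal model of `⟨𝓡, F⟩`: a model mapping homomorphically into
every model. -/
def IsUniversalModel (𝓡 : RuleSet) (F : FactBase) (M : Set Atom) : Prop :=
  IsModelOfKB 𝓡 F M ∧ ∀ N : Set Atom, IsModelOfKB 𝓡 F N → ∃ σ : Subst, IsHom σ M N

/-- An atom set entails a Boolean conjunctive query `Q` if `Q` maps
homomorphically into it. -/
def EntailsQ (S : Set Atom) (Q : Finset Atom) : Prop := ∃ σ : Subst, IsHom σ ↑Q S

/-- `⟨𝓡, F⟩ ⊨ Q`: every model of the KB entails `Q`. -/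
def KBEntails (𝓡 : RuleSet) (F : FactBase) (Q : Finset Atom) : Prop :=
  ∀ M : Set Atom, IsModelOfKB 𝓡 F M → EntailsQ M Q

/-- `R(F)`: the minimal atom set including `F` and `out(t)` for every trigger `t`
with rule `R` on `F`. -/
def ruleStep (R : Rule) (S : Set Atom) : Set Atom :=
  S ∪ {a | ∃ t : Trigger, t.rule = R ∧ IsHom t.map ↑R.body S ∧ a ∈ t.out}

/-- `𝓡(F) = ⋃_{R ∈ 𝓡} R(F)` (together with `F`). -/
def setStep (𝓡 : RuleSet) (S : Set Atom) : Set Atom := S ∪ ⋃ R ∈ 𝓡, ruleStep R S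

/-- The breadth-first chase `Ch_i(⟨𝓡, F⟩)`. -/
def ch (𝓡 : RuleSet) (F : FactBase) : ℕ → Set Atom
  | 0 => ↑F
  | i + 1 => setStep 𝓡 (ch 𝓡 F i)

/-- The bounded derivation depth property. -/
def BDDP (𝓡 : RuleSet) : Prop :=
  ∀ Q : Finset Atom, ∃ k : ℕ, ∀ F : FactBase, KBEntails 𝓡 F Q ↔ EntailsQ (ch 𝓡 F k) Q

/-! ### Conservative extensions -/

/-- The restriction of an atom set to the atoms over a given set of predicates. -/
def restrictTo (M : Set Atom) (P : Set ℕ) : Set Atom := {a ∈ M | a.pred ∈ P}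

/-- The terms (domain elements) of an atom set. -/
def termsOf (M : Set Atom) : Set Term := {u | ∃ a ∈ M, u ∈ a.args}

/-- `𝓡'` is a conservative extension of `𝓡`. -/
def ConservativeExt (𝓡 𝓡' : RuleSet) : Prop :=
  (↑(RuleSet.predsF 𝓡) : Set ℕ) ⊆ ↑(RuleSet.predsF 𝓡') ∧
  (∀ M : Set Atom, IsModelOfRules 𝓡' M →
    IsModelOfRules 𝓡 (restrictTo M ↑(RuleSet.predsF 𝓡))) ∧
  (∀ M : Set Atom, IsModelOfRules 𝓡 M →
    ∃ M' : Set Atom, M ⊆ M' ∧ IsModelOfRules 𝓡' M' ∧ termsOf M' = termsOf M ∧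
      restrictTo M' ↑(RuleSet.predsF 𝓡) = restrictTo M ↑(RuleSet.predsF 𝓡))

/-- `𝓡'` is a universal-conservative extension of `𝓡`. -/
def UnivConservativeExt (𝓡 𝓡' : RuleSet) : Prop :=
  (↑(RuleSet.predsF 𝓡) : Set ℕ) ⊆ ↑(RuleSet.predsF 𝓡') ∧
  ∀ F : FactBase, (∀ a ∈ F, a.pred ∈ RuleSet.predsF 𝓡) →
    (∀ M : Set Atom, IsUniversalModel 𝓡' F M →
      IsUniversalModel 𝓡 F (restrictTo M ↑(RuleSet.predsF 𝓡))) ∧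
    (∀ M : Set Atom, IsUniversalModel 𝓡 F M →
      ∃ M' : Set Atom, M ⊆ M' ∧ IsUniversalModel 𝓡' F M' ∧ termsOf M' = termsOf M ∧
        restrictTo M' ↑(RuleSet.predsF 𝓡) = restrictTo M ↑(RuleSet.predsF 𝓡))

def aA (t : Term) : Atom := ⟨0, [t]⟩
def aR (t u : Term) : Atom := ⟨1, [t, u]⟩
def aS (t u : Term) : Atom := ⟨2, [t, u]⟩
def aH (t u : Term) : Atom := ⟨3, [t, u]⟩
def vx : Term := Term.var 0
def vy : Term := Term.var 1
def vz : Term := Term.var 2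

/-- `𝓡 = {A(x) → ∃y.(R(x,x) ∧ H(x,y)); R(x,y) ∧ S(y,z) → S(x,x);
  A(x) ∧ S(x,y) → A(y); A(x) → ∃y.R(x,y); R(x,y) → ∃z.S(y,z)}`. -/
def R6set : RuleSet :=
  { ⟨{aA vx}, {aR vx vx, aH vx vy}, Finset.singleton_nonempty _, Finset.insert_nonempty _ _⟩,
    ⟨{aR vx vy, aS vy vz}, {aS vx vx}, Finset.insert_nonempty _ _, Finset.singleton_nonempty _⟩,
    ⟨{aA vx, aS vx vy}, {aA vy}, Finset.insert_nonempty _ _, Finset.singleton_nonempty _⟩,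
    ⟨{aA vx}, {aR vx vy}, Finset.singleton_nonempty _, Finset.singleton_nonempty _⟩,
    ⟨{aR vx vy}, {aS vy vz}, Finset.singleton_nonempty _, Finset.singleton_nonempty _⟩ }

/-! ### Variables, triggers and retractions -/

theorem Atom.mem_vars {a : Atom} {v : ℕ} : v ∈ a.vars ↔ Term.var v ∈ a.args := by
  obtain ⟨p, l⟩ := a
  change v ∈ l.foldr (fun t s => t.vars ∪ s) ∅ ↔ Term.var v ∈ l
  induction l with
  | nil => simp
  | cons t l ih =>
    rw [List.foldr_cons, Finset.mem_union, ih, List.mem_cons]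
    cases t <;> simp [Term.vars]

theorem FactBase.mem_vars {B : FactBase} {v : ℕ} :
    v ∈ FactBase.vars B ↔ ∃ a ∈ B, Term.var v ∈ a.args := by
  simp only [FactBase.vars, Finset.mem_sup, Atom.mem_vars]

theorem mem_setVars {S : Set Atom} {v : ℕ} :
    v ∈ setVars S ↔ ∃ a ∈ S, Term.var v ∈ a.args := by
  simp only [setVars, Set.mem_ofPred_eq, Atom.mem_vars]

theorem freshVar_congr {R : Rule} {π π' : Subst} (z : ℕ)
    (h : ∀ v ∈ FactBase.vars R.body, π v = π' v) :
    Trigger.freshVar ⟨R, π⟩ z = Trigger.freshVar ⟨R, π'⟩ z := by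
  have : ((FactBase.vars R.body).sort (· ≤ ·)).map π
      = ((FactBase.vars R.body).sort (· ≤ ·)).map π' :=
    List.map_congr_left fun v hv => h v ((Finset.mem_sort _).1 hv)
  simp only [Trigger.freshVar, this]

theorem freshVar_inj {t t' : Trigger} {z z' : ℕ} (h : t.freshVar z = t'.freshVar z') :
    z = z' ∧ t.rule = t'.rule ∧ ∀ v ∈ FactBase.vars t.rule.body, t.map v = t'.map v := by
  obtain ⟨R, π⟩ := t
  obtain ⟨R', π'⟩ := t'
  obtain ⟨h1, h2⟩ := Nat.pair_eq_pair.1 h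
  obtain ⟨rfl, h3⟩ := Prod.mk.inj (Encodable.encode_injective h1)
  exact ⟨h2, rfl, fun v hv =>
    List.map_inj_left.1 h3 v ((Finset.mem_sort _).2 hv)⟩

theorem applyTerm_eq_of_isRetraction {σ : Subst} {G O : FactBase}
    (h : IsRetraction σ ↑(G ∪ O) ↑G) {a : Atom} (ha : a ∈ G) {u : Term} (hu : u ∈ a.args) :
    applyTerm σ u = u := by
  cases u with
  | const c => rfl
  | var v =>
    exact h.2 v (mem_setVars.2 ⟨a, by simp [ha], hu⟩) (mem_setVars.2 ⟨a, ha, hu⟩)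

theorem Atom.subst_eq_self {σ : Subst} {a : Atom}
    (h : ∀ v, Term.var v ∈ a.args → σ v = Term.var v) : a.subst σ = a := by
  obtain ⟨p, l⟩ := a
  simp only [Atom.subst, Atom.mk.injEq, true_and]
  conv_rhs => rw [← List.map_id l]
  refine List.map_congr_left fun u hu => ?_
  cases u with
  | const c => rfl
  | var v => exact h v hu

theorem not_applicable_of_out_subset {t : Trigger} {G : FactBase} (h : t.out ⊆ G) :
    ¬ Applicable .R t G := by
  intro hA
  refine hA ⟨Term.var, fun a ha => ?_, fun _ _ _ => rfl⟩
  rw [Atom.subst_eq_self fun _ _ => rfl]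
  rw [Finset.union_eq_left.2 h] at ha
  exact ha

theorem applyTerm_ite (n : ℕ) (u : Term) :
    applyTerm (fun v => if v = n then u else .var v) u = u ∧
      applyTerm (fun v => if v = n then u else .var v) (.var n) = u := by
  refine ⟨?_, if_pos rfl⟩
  cases u with
  | const c => rfl
  | var v => simp [applyTerm]

/-- A trigger whose output contains only one new term, a variable not occurring in `G`, is not
applicable if that variable can be instantiated in `G`. -/
theorem not_applicable_of_fresh {t : Trigger} {G : FactBase} {a : Atom} {n : ℕ} {u : Term}
    (hn : ∀ b ∈ G, Term.var n ∉ b.args) (hout : t.out = {a})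
    (ha : a.subst (fun v => if v = n then u else .var v) ∈ G) : ¬ Applicable .R t G := by
  refine fun hA => hA ⟨fun v => if v = n then u else .var v, fun b hb => ?_, fun v _ hv => ?_⟩
  · rcases Finset.mem_union.1 (Finset.mem_coe.1 hb) with hb | hb
    · rw [Atom.subst_eq_self]
      · exact hb
      · intro v hv
        refine if_neg ?_
        rintro rfl
        exact hn b hb hv
    · rw [hout, Finset.mem_singleton] at hb
      exact hb ▸ ha
  · obtain ⟨b, hb, hbv⟩ := mem_setVars.1 hv
    refine if_neg ?_
    rintro rfl
    exact hn b hb hbv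

/-- A Datalog trigger outputs only atoms over terms of the factbase, so that when it is not
applicable its output is already present. -/
theorem satisfiesRule_of_not_applicable {R : Rule} {G : FactBase} (hR : R.IsDatalog)
    (h : ∀ t : Trigger, t.rule = R → t.IsOn G → ¬ Applicable .R t G) :
    SatisfiesRule ↑G R := by
  intro π hπ
  refine ⟨π, fun _ _ => rfl, fun a ha => ?_⟩
  obtain ⟨σ, hσ⟩ := not_not.1 (h ⟨R, π⟩ rfl hπ)
  have hext : (⟨R, π⟩ : Trigger).ext = π := by
    funext v
    have hv : v ∉ R.exVars := by rw [hR]; simp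
    simp [Trigger.ext, hv]
  have hmem : a.subst π ∈ (⟨R, π⟩ : Trigger).out := by
    rw [Trigger.out, hext]
    exact Finset.mem_image_of_mem _ ha
  have h1 := hσ.1 (a.subst π) (by simp [hmem])
  have h2 : (a.subst π).subst σ = a.subst π := by
    refine Atom.subst_eq_self fun v hv => ?_
    obtain ⟨u, hu, huv⟩ := List.mem_map.1 hv
    cases u with
    | const c => simp [applyTerm] at huv
    | var w =>
      have hw : w ∈ FactBase.vars R.body := by
        by_contra hw
        have : w ∈ R.exVars :=
          Finset.mem_sdiff.2 ⟨FactBase.mem_vars.2 ⟨a, ha, hu⟩, hw⟩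
        rw [hR] at this
        simp at this
      obtain ⟨b, hb, hbw⟩ := FactBase.mem_vars.1 hw
      have : applyTerm σ (Term.var v) = Term.var v :=
        applyTerm_eq_of_isRetraction hσ (hπ b hb) (List.mem_map.2 ⟨_, hbw, huv⟩)
      exact this
  rwa [h2] at h1

/-! ### Building finite fair derivations -/

/-- `G` has a finite fair Datalog-first restricted derivation. -/
def Terminates (𝓡 : RuleSet) (G : FactBase) : Prop :=
  ∃ D : Derivation 𝓡 G, D.IsX .R ∧ D.DatalogFirst ∧ D.Fair .R ∧ D.Finite

theorem Terminates.of_not_applicable {𝓡 : RuleSet} {G : FactBase}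
    (h : ∀ t : Trigger, t.rule ∈ 𝓡 → t.IsOn G → ¬ Applicable .R t G) (t₀ : Trigger) :
    Terminates 𝓡 G := by
  refine ⟨⟨0, fun _ => G, fun _ => t₀, rfl, ?_, ?_, ?_, ?_, ?_⟩, ?_, ?_, ?_, ?_⟩
  · intro i hi; simp at hi
  · intro i hi; simp at hi
  · intro i hi; simp at hi
  · intro i hi; simp at hi
  · intro i hi; rfl
  · intro i hi; simp at hi
  · intro i hi; simp at hi
  · intro i _ t ht hon hA
    exact absurd hA (h t ht hon)
  · simp [Derivation.Finite]

theorem Terminates.of_step {𝓡 : RuleSet} {G : FactBase} {t : Trigger} (ht : t.rule ∈ 𝓡)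
    (hon : t.IsOn G) (hA : Applicable .R t G)
    (hdf : ¬ t.rule.IsDatalog → ∀ R ∈ 𝓡, R.IsDatalog → SatisfiesRule ↑G R)
    (h : Terminates 𝓡 (G ∪ t.out)) : Terminates 𝓡 G := by
  obtain ⟨D, hX, hD, hF, hfin⟩ := h
  have lt_iff (i : ℕ) : ((i + 1 : ℕ) : ℕ∞) < D.len + 1 ↔ (i : ℕ∞) < D.len := by
    push_cast
    exact ENat.add_lt_add_iff_right (by simp)
  have le_iff (i : ℕ) : ((i + 1 : ℕ) : ℕ∞) ≤ D.len + 1 ↔ (i : ℕ∞) ≤ D.len := by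
    push_cast
    exact ENat.add_le_add_iff_right (by simp)
  refine ⟨⟨D.len + 1, fun n => n.casesOn G D.fb, fun n => n.casesOn t D.tr, rfl,
    ?_, ?_, ?_, ?_, ?_⟩, ?_, ?_, ?_, ?_⟩
  · rintro (_ | i) hi
    · exact ht
    · exact D.rule_mem i ((lt_iff i).1 hi)
  · rintro (_ | i) hi
    · exact hon
    · exact D.trig_on i ((lt_iff i).1 hi)
  · rintro (_ | i) hi
    · exact fun hs => not_applicable_of_out_subset hs hA
    · exact D.trig_new i ((lt_iff i).1 hi)
  · rintro (_ | i) hi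
    · exact D.fb_zero
    · exact D.fb_succ i ((lt_iff i).1 hi)
  · rintro (_ | i) hi
    · exact absurd (by simp) hi
    · exact D.fb_stall i (fun h => hi ((lt_iff i).2 h))
  · rintro (_ | i) hi
    · exact hA
    · exact hX i ((lt_iff i).1 hi)
  · rintro (_ | i) hi
    · exact hdf
    · exact hD i ((lt_iff i).1 hi)
  · rintro (_ | i) hi t' ht' hon' hA'
    · by_cases hA0 : Applicable .R t' (D.fb 0)
      · have hon0 : t'.IsOn (D.fb 0) := by
          intro a ha
          rw [D.fb_zero]
          exact Finset.mem_coe.2 (Finset.mem_union_left _ (hon' a ha))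
        obtain ⟨j, -, hj, hn⟩ := hF 0 (by simp) t' ht' hon0 hA0
        exact ⟨j + 1, by omega, (le_iff j).2 hj, hn⟩
      · exact ⟨1, by omega, (le_iff 0).2 (by simp), hA0⟩
    · obtain ⟨j, hij, hj, hn⟩ := hF i ((le_iff i).1 hi) t' ht' hon' hA'
      exact ⟨j + 1, by omega, (le_iff j).2 hj, hn⟩
  · simpa [Derivation.Finite] using hfin

/-! ### The rules -/

/-- `A(x) → ∃y.(R(x,x) ∧ H(x,y))` -/
def ruleLoop : Rule :=
  ⟨{aA vx}, {aR vx vx, aH vx vy}, Finset.singleton_nonempty _, Finset.insert_nonempty _ _⟩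

/-- `R(x,y) ∧ S(y,z) → S(x,x)` -/
def ruleBack : Rule :=
  ⟨{aR vx vy, aS vy vz}, {aS vx vx}, Finset.insert_nonempty _ _, Finset.singleton_nonempty _⟩

/-- `A(x) ∧ S(x,y) → A(y)` -/
def ruleProp : Rule :=
  ⟨{aA vx, aS vx vy}, {aA vy}, Finset.insert_nonempty _ _, Finset.singleton_nonempty _⟩

/-- `A(x) → ∃y.R(x,y)` -/
def ruleR : Rule :=
  ⟨{aA vx}, {aR vx vy}, Finset.singleton_nonempty _, Finset.singleton_nonempty _⟩

/-- `R(x,y) → ∃z.S(y,z)` -/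
def ruleS : Rule :=
  ⟨{aR vx vy}, {aS vy vz}, Finset.singleton_nonempty _, Finset.singleton_nonempty _⟩

/-- `A(x) → R(x,x)` -/
def ruleLoopR : Rule :=
  ⟨{aA vx}, {aR vx vx}, Finset.singleton_nonempty _, Finset.singleton_nonempty _⟩

/-- `A(x) → ∃y.H(x,y)` -/
def ruleLoopH : Rule :=
  ⟨{aA vx}, {aH vx vy}, Finset.singleton_nonempty _, Finset.singleton_nonempty _⟩

theorem mem_R6set {R : Rule} : R ∈ R6set ↔
    R = ruleLoop ∨ R = ruleBack ∨ R = ruleProp ∨ R = ruleR ∨ R = ruleS := by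
  simp only [R6set, Finset.mem_insert, Finset.mem_singleton]
  rfl

theorem vars_aA {v : ℕ} : v ∈ FactBase.vars {aA vx} ↔ v = 0 := by
  simp [FactBase.mem_vars, aA, vx]

theorem vars_aR {v : ℕ} : v ∈ FactBase.vars {aR vx vy} ↔ v = 0 ∨ v = 1 := by
  simp [FactBase.mem_vars, aR, vx, vy]

theorem exVars_ruleLoop : ruleLoop.exVars = {1} := by
  ext v
  simp [Rule.exVars, ruleLoop, FactBase.mem_vars, aA, aR, aH, vx, vy]
  omega

theorem exVars_ruleBack : ruleBack.exVars = ∅ := by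
  ext v
  simp [Rule.exVars, ruleBack, FactBase.mem_vars, aR, aS, vx, vy, vz]
  omega

theorem exVars_ruleProp : ruleProp.exVars = ∅ := by
  ext v
  simp [Rule.exVars, ruleProp, FactBase.mem_vars, aA, aS, vx, vy]
  omega

theorem exVars_ruleR : ruleR.exVars = {1} := by
  ext v
  simp [Rule.exVars, ruleR, FactBase.mem_vars, aA, aR, vx, vy]
  omega

theorem exVars_ruleS : ruleS.exVars = {2} := by
  ext v
  simp [Rule.exVars, ruleS, FactBase.mem_vars, aR, aS, vx, vy, vz]
  omega

theorem exVars_ruleLoopR : ruleLoopR.exVars = ∅ := by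
  ext v
  simp [Rule.exVars, ruleLoopR, FactBase.mem_vars, aA, aR, vx]

theorem exVars_ruleLoopH : ruleLoopH.exVars = {1} := by
  ext v
  simp [Rule.exVars, ruleLoopH, FactBase.mem_vars, aA, aH, vx, vy]
  omega

/-- The fresh variable of `A(x) → ∃y.(R(x,x) ∧ H(x,y))`. -/
def freshLoop (x : Term) : Term := .var (Trigger.freshVar ⟨ruleLoop, fun _ => x⟩ 1)

/-- The fresh variable of `A(x) → ∃y.R(x,y)`. -/
def freshR (x : Term) : Term := .var (Trigger.freshVar ⟨ruleR, fun _ => x⟩ 1)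

/-- The fresh variable of `R(x,y) → ∃z.S(y,z)`. -/
def freshS (x y : Term) : Term :=
  .var (Trigger.freshVar ⟨ruleS, fun v => if v = 0 then x else y⟩ 2)

/-- The fresh variable of `A(x) → ∃y.H(x,y)`. -/
def freshH (x : Term) : Term := .var (Trigger.freshVar ⟨ruleLoopH, fun _ => x⟩ 1)

theorem freshR_injective : Function.Injective freshR := fun _ _ h =>
  (freshVar_inj (Term.var.inj h)).2.2 0 (vars_aA.2 rfl)

theorem freshS_inj {x y x' y' : Term} (h : freshS x y = freshS x' y') : x = x' ∧ y = y' := by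
  have h := (freshVar_inj (Term.var.inj h)).2.2
  exact ⟨by simpa using h 0 (vars_aR.2 (.inl rfl)), by simpa using h 1 (vars_aR.2 (.inr rfl))⟩

theorem freshR_ne_freshS {x y z : Term} : freshR x ≠ freshS y z := fun h =>
  absurd (freshVar_inj (Term.var.inj h)).1 (by decide)

theorem freshLoop_ne_freshS {x y z : Term} : freshLoop x ≠ freshS y z := fun h =>
  absurd (freshVar_inj (Term.var.inj h)).1 (by decide)

theorem freshR_ne_freshH {x y : Term} : freshR x ≠ freshH y := fun h => by
  have := congrArg Rule.head (freshVar_inj (Term.var.inj h)).2.1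
  simp [ruleR, ruleLoopH, aR, aH] at this

theorem out_ruleLoop (π : Subst) : Trigger.out ⟨ruleLoop, π⟩ =
    {aR (π 0) (π 0), aH (π 0) (freshLoop (π 0))} := by
  have : Trigger.freshVar ⟨ruleLoop, π⟩ 1 = Trigger.freshVar ⟨ruleLoop, fun _ => π 0⟩ 1 :=
    freshVar_congr _ fun v hv => by rw [vars_aA.1 hv]
  rw [freshLoop, ← this]
  change Finset.image (Atom.subst (Trigger.ext ⟨ruleLoop, π⟩)) {aR vx vx, aH vx vy} = _
  simp [Finset.image_insert, Trigger.ext, exVars_ruleLoop, Atom.subst, applyTerm, aR, aH, vx, vy]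

theorem out_ruleBack (π : Subst) : Trigger.out ⟨ruleBack, π⟩ = {aS (π 0) (π 0)} := by
  change Finset.image (Atom.subst (Trigger.ext ⟨ruleBack, π⟩)) {aS vx vx} = _
  simp [Trigger.ext, exVars_ruleBack, Atom.subst, applyTerm, aS, vx]

theorem out_ruleProp (π : Subst) : Trigger.out ⟨ruleProp, π⟩ = {aA (π 1)} := by
  change Finset.image (Atom.subst (Trigger.ext ⟨ruleProp, π⟩)) {aA vy} = _
  simp [Trigger.ext, exVars_ruleProp, Atom.subst, applyTerm, aA, vy]

theorem out_ruleR (π : Subst) : Trigger.out ⟨ruleR, π⟩ = {aR (π 0) (freshR (π 0))} := by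
  have : Trigger.freshVar ⟨ruleR, π⟩ 1 = Trigger.freshVar ⟨ruleR, fun _ => π 0⟩ 1 :=
    freshVar_congr _ fun v hv => by rw [vars_aA.1 hv]
  rw [freshR, ← this]
  change Finset.image (Atom.subst (Trigger.ext ⟨ruleR, π⟩)) {aR vx vy} = _
  simp [Trigger.ext, exVars_ruleR, Atom.subst, applyTerm, aR, vx, vy]

theorem out_ruleS (π : Subst) :
    Trigger.out ⟨ruleS, π⟩ = {aS (π 1) (freshS (π 0) (π 1))} := by
  have : Trigger.freshVar ⟨ruleS, π⟩ 2 =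
      Trigger.freshVar ⟨ruleS, fun v => if v = 0 then π 0 else π 1⟩ 2 :=
    freshVar_congr _ fun v hv => by rcases vars_aR.1 hv with rfl | rfl <;> simp
  rw [freshS, ← this]
  change Finset.image (Atom.subst (Trigger.ext ⟨ruleS, π⟩)) {aS vy vz} = _
  simp [Trigger.ext, exVars_ruleS, Atom.subst, applyTerm, aS, vy, vz]

theorem out_ruleLoopR (π : Subst) : Trigger.out ⟨ruleLoopR, π⟩ = {aR (π 0) (π 0)} := by
  change Finset.image (Atom.subst (Trigger.ext ⟨ruleLoopR, π⟩)) {aR vx vx} = _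
  simp [Trigger.ext, exVars_ruleLoopR, Atom.subst, applyTerm, aR, vx]

theorem out_ruleLoopH (π : Subst) :
    Trigger.out ⟨ruleLoopH, π⟩ = {aH (π 0) (freshH (π 0))} := by
  have : Trigger.freshVar ⟨ruleLoopH, π⟩ 1 = Trigger.freshVar ⟨ruleLoopH, fun _ => π 0⟩ 1 :=
    freshVar_congr _ fun v hv => by rw [vars_aA.1 hv]
  rw [freshH, ← this]
  change Finset.image (Atom.subst (Trigger.ext ⟨ruleLoopH, π⟩)) {aH vx vy} = _
  simp [Trigger.ext, exVars_ruleLoopH, Atom.subst, applyTerm, aH, vx, vy]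

theorem isOn_aA {R : Rule} (hR : R.body = {aA vx}) {π : Subst} {G : FactBase} :
    Trigger.IsOn ⟨R, π⟩ G ↔ aA (π 0) ∈ G := by
  simp [Trigger.IsOn, IsHom, hR, Atom.subst, applyTerm, aA, vx]

theorem isOn_ruleBack {π : Subst} {G : FactBase} :
    Trigger.IsOn ⟨ruleBack, π⟩ G ↔ aR (π 0) (π 1) ∈ G ∧ aS (π 1) (π 2) ∈ G := by
  simp [Trigger.IsOn, IsHom, ruleBack, Atom.subst, applyTerm, aR, aS, vx, vy, vz]

theorem isOn_ruleProp {π : Subst} {G : FactBase} :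
    Trigger.IsOn ⟨ruleProp, π⟩ G ↔ aA (π 0) ∈ G ∧ aS (π 0) (π 1) ∈ G := by
  simp [Trigger.IsOn, IsHom, ruleProp, Atom.subst, applyTerm, aA, aS, vx, vy]

theorem isOn_ruleS {π : Subst} {G : FactBase} :
    Trigger.IsOn ⟨ruleS, π⟩ G ↔ aR (π 0) (π 1) ∈ G := by
  simp [Trigger.IsOn, IsHom, ruleS, Atom.subst, applyTerm, aR, vx, vy]

/-! ### Consequences of saturation -/

/-- No trigger on `G` using the rule `R` is applicable in the restricted chase. -/
def Saturated (R : Rule) (G : FactBase) : Prop :=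
  ∀ t : Trigger, t.rule = R → t.IsOn G → ¬ Applicable .R t G

theorem Saturated.exists_aR {G : FactBase} (h : Saturated ruleR G) {x : Term}
    (hx : aA x ∈ G) : ∃ y, aR x y ∈ G := by
  obtain ⟨σ, hσ⟩ := not_not.1 (h ⟨ruleR, fun _ => x⟩ rfl ((isOn_aA rfl).2 hx))
  refine ⟨applyTerm σ (freshR x), ?_⟩
  have h1 := hσ.1 (aR x (freshR x)) (by simp [out_ruleR])
  have h2 : (aR x (freshR x)).subst σ = aR (applyTerm σ x) (applyTerm σ (freshR x)) := rfl
  rwa [h2, applyTerm_eq_of_isRetraction hσ hx (u := x) (by simp [aA])] at h1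

theorem Saturated.exists_aS {G : FactBase} (h : Saturated ruleS G) {x y : Term}
    (hxy : aR x y ∈ G) : ∃ z, aS y z ∈ G := by
  obtain ⟨σ, hσ⟩ := not_not.1
    (h ⟨ruleS, fun v => if v = 0 then x else y⟩ rfl (isOn_ruleS.2 (by simpa using hxy)))
  refine ⟨applyTerm σ (freshS x y), ?_⟩
  have h1 := hσ.1 (aS y (freshS x y)) (by simp [out_ruleS])
  have h2 : (aS y (freshS x y)).subst σ = aS (applyTerm σ y) (applyTerm σ (freshS x y)) := rfl
  rwa [h2, applyTerm_eq_of_isRetraction hσ hxy (u := y) (by simp [aR])] at h1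

theorem aS_of_satisfiesRule {G : FactBase} (h : SatisfiesRule ↑G ruleBack) {x y z : Term}
    (hxy : aR x y ∈ G) (hyz : aS y z ∈ G) : aS x x ∈ G := by
  obtain ⟨σ, hσ, hh⟩ := h (fun v => if v = 0 then x else if v = 1 then y else z)
    (isOn_ruleBack.2 (by simpa using ⟨hxy, hyz⟩))
  have h0 : σ 0 = x := by
    rw [hσ 0 (by simp [FactBase.mem_vars, ruleBack, aR, aS, vx, vy, vz])]
    simp
  have := hh (aS vx vx) (by simp [ruleBack])
  have h1 : (aS vx vx).subst σ = aS (σ 0) (σ 0) := rfl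
  rwa [h1, h0] at this

theorem aA_of_satisfiesRule {G : FactBase} (h : SatisfiesRule ↑G ruleProp) {x y : Term}
    (hx : aA x ∈ G) (hxy : aS x y ∈ G) : aA y ∈ G := by
  obtain ⟨σ, hσ, hh⟩ := h (fun v => if v = 0 then x else y)
    (isOn_ruleProp.2 (by simpa using ⟨hx, hxy⟩))
  have h0 : σ 1 = y := by
    rw [hσ 1 (by simp [FactBase.mem_vars, ruleProp, aA, aS, vx, vy])]
    simp
  have := hh (aA vy) (by simp [ruleProp])
  have h1 : (aA vy).subst σ = aA (σ 1) := rfl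
  rwa [h1, h0] at this

theorem aR_of_satisfiesRule {G : FactBase} (h : SatisfiesRule ↑G ruleLoopR) {x : Term}
    (hx : aA x ∈ G) : aR x x ∈ G := by
  obtain ⟨σ, hσ, hh⟩ := h (fun _ => x) ((isOn_aA (R := ruleLoopR) rfl).2 hx)
  have h0 : σ 0 = x := hσ 0 (vars_aA.2 rfl)
  have := hh (aR vx vx) (by simp [ruleLoopR])
  have h1 : (aR vx vx).subst σ = aR (σ 0) (σ 0) := rfl
  rwa [h1, h0] at this

/-! ### Termination for the original rule set -/

/-- The terms occurring in the factbase `F`. -/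
def FactBase.terms (F : FactBase) : Set Term := {u | ∃ a ∈ F, u ∈ a.args}

/-- The terms that may become instances of `A` in the chase from `F`. -/
def aTerms (F : FactBase) : Set Term :=
  F.terms ∪ Set.image2 freshS (F.terms ∪ freshR ⁻¹' F.terms) F.terms

/-- The pairs that may become instances of `R` in the chase from `F`. -/
def RBound (F : FactBase) (x y : Term) : Prop :=
  (x ∈ F.terms ∧ y ∈ F.terms) ∨ (x ∈ aTerms F ∧ y = freshR x) ∨ (x ∈ aTerms F ∧ y = x)

/-- The pairs that may become instances of `S` in the chase from `F`. -/
def SBound (F : FactBase) (y z : Term) : Prop :=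
  (y ∈ F.terms ∧ z ∈ F.terms) ∨ (y ∈ aTerms F ∧ z = y) ∨
    ∃ x, RBound F x y ∧ z = freshS x y ∧ (y ∈ aTerms F → z ∈ aTerms F)

/-- A finite set of atoms that bounds the chase from `F`. -/
def chaseBound (F : FactBase) : Set Atom :=
  {a | a ∈ F ∨ (∃ u ∈ aTerms F, a = aA u) ∨ (∃ x y, RBound F x y ∧ a = aR x y) ∨
    (∃ y z, SBound F y z ∧ a = aS y z) ∨ ∃ x ∈ aTerms F, a = aH x (freshLoop x)}

theorem FactBase.finite_terms (F : FactBase) : F.terms.Finite := by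
  have : F.terms = ⋃ a ∈ F, {u | u ∈ a.args} := by
    ext u; simp [FactBase.terms]
  rw [this]
  exact Set.Finite.biUnion F.finite_toSet fun a _ => List.finite_toSet a.args

theorem finite_aTerms (F : FactBase) : (aTerms F).Finite :=
  F.finite_terms.union <| Set.Finite.image2 _
    (F.finite_terms.union (F.finite_terms.preimage freshR_injective.injOn)) F.finite_terms

theorem finite_RBound (F : FactBase) : {p : Term × Term | RBound F p.1 p.2}.Finite := by
  refine ((F.finite_terms.prod F.finite_terms).union
    (((finite_aTerms F).image fun x => (x, freshR x)).union
      ((finite_aTerms F).image fun x => (x, x)))).subset ?_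
  rintro ⟨x, y⟩ (⟨hx, hy⟩ | ⟨hx, h⟩ | ⟨hx, h⟩)
  · exact .inl ⟨hx, hy⟩
  · exact .inr (.inl ⟨x, hx, Prod.ext rfl h.symm⟩)
  · exact .inr (.inr ⟨x, hx, Prod.ext rfl h.symm⟩)

theorem finite_SBound (F : FactBase) : {p : Term × Term | SBound F p.1 p.2}.Finite := by
  refine ((F.finite_terms.prod F.finite_terms).union
    (((finite_aTerms F).image fun x => (x, x)).union
      ((finite_RBound F).image fun p => (p.2, freshS p.1 p.2)))).subset ?_
  rintro ⟨y, z⟩ (⟨hy, hz⟩ | ⟨hy, h⟩ | ⟨x, hxy, h, -⟩)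
  · exact .inl ⟨hy, hz⟩
  · exact .inr (.inl ⟨y, hy, Prod.ext rfl h.symm⟩)
  · exact .inr (.inr ⟨(x, y), hxy, Prod.ext rfl h.symm⟩)

theorem finite_chaseBound (F : FactBase) : (chaseBound F).Finite := by
  refine (F.finite_toSet.union (((finite_aTerms F).image aA).union
    (((finite_RBound F).image fun p => aR p.1 p.2).union
    (((finite_SBound F).image fun p => aS p.1 p.2).union
      ((finite_aTerms F).image fun x => aH x (freshLoop x)))))).subset ?_
  rintro a (h | ⟨u, hu, rfl⟩ | ⟨x, y, h, rfl⟩ | ⟨y, z, h, rfl⟩ | ⟨x, hx, rfl⟩)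
  · exact .inl h
  · exact .inr (.inl ⟨u, hu, rfl⟩)
  · exact .inr (.inr (.inl ⟨(x, y), h, rfl⟩))
  · exact .inr (.inr (.inr (.inl ⟨(y, z), h, rfl⟩)))
  · exact .inr (.inr (.inr (.inr ⟨x, hx, rfl⟩)))

section

variable {F : FactBase}

theorem terms_subset_aTerms : F.terms ⊆ aTerms F := Set.subset_union_left

theorem freshR_mem_aTerms {x : Term} (h : freshR x ∈ aTerms F) : freshR x ∈ F.terms := by
  rcases h with h | ⟨y, -, z, -, h⟩
  · exact h
  · exact absurd h.symm freshR_ne_freshS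

theorem mem_terms_of_freshS_mem_aTerms {x y : Term} (h : freshS x y ∈ aTerms F) :
    freshS x y ∈ F.terms ∨ y ∈ F.terms := by
  rcases h with h | ⟨x', -, y', hy', h⟩
  · exact .inl h
  · exact .inr ((freshS_inj h).2 ▸ hy')

theorem mem_aTerms_of_aA {u : Term} (h : aA u ∈ chaseBound F) : u ∈ aTerms F := by
  rcases h with h | ⟨v, hv, h⟩ | ⟨x, y, -, h⟩ | ⟨x, y, -, h⟩ | ⟨x, -, h⟩
  · exact terms_subset_aTerms ⟨_, h, by simp [aA]⟩
  all_goals simp [aA, aR, aS, aH] at h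
  exact h ▸ hv

theorem RBound_of_aR {x y : Term} (h : aR x y ∈ chaseBound F) : RBound F x y := by
  rcases h with h | ⟨v, hv, h⟩ | ⟨x, y, hxy, h⟩ | ⟨x, y, -, h⟩ | ⟨x, -, h⟩
  · exact .inl ⟨⟨_, h, by simp [aR]⟩, ⟨_, h, by simp [aR]⟩⟩
  all_goals simp [aA, aR, aS, aH] at h
  obtain ⟨rfl, rfl⟩ := h
  exact hxy

theorem SBound_of_aS {x y : Term} (h : aS x y ∈ chaseBound F) : SBound F x y := by
  rcases h with h | ⟨v, hv, h⟩ | ⟨x, y, -, h⟩ | ⟨x, y, hxy, h⟩ | ⟨x, -, h⟩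
  · exact .inl ⟨⟨_, h, by simp [aS]⟩, ⟨_, h, by simp [aS]⟩⟩
  all_goals simp [aA, aR, aS, aH] at h
  obtain ⟨rfl, rfl⟩ := h
  exact hxy

theorem RBound.left_mem {x y : Term} (h : RBound F x y) : x ∈ aTerms F := by
  rcases h with ⟨h, -⟩ | ⟨h, -⟩ | ⟨h, -⟩
  · exact terms_subset_aTerms h
  · exact h
  · exact h

theorem SBound.right_mem {y z : Term} (h : SBound F y z) (hy : y ∈ aTerms F) :
    z ∈ aTerms F := by
  rcases h with ⟨-, h⟩ | ⟨-, rfl⟩ | ⟨x, -, -, h⟩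
  · exact terms_subset_aTerms h
  · exact hy
  · exact h hy

/-- Unless it occurs in `F`, the fresh variable `freshS u u` of a loop `R(u,u)` on a term outside
`F` occurs only in the atom `S(u, freshS u u)`. -/
theorem freshS_occurs {u : Term} (hu : u ∉ F.terms) (hT : freshS u u ∉ F.terms) {a : Atom}
    (ha : a ∈ chaseBound F) (h : freshS u u ∈ a.args) : a = aS u (freshS u u) := by
  have hA : freshS u u ∉ aTerms F := fun h =>
    (mem_terms_of_freshS_mem_aTerms h).elim hT hu
  have hR {x y : Term} (hxy : RBound F x y) : freshS u u ≠ x ∧ freshS u u ≠ y := by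
    refine ⟨fun h => hA (h ▸ hxy.left_mem), ?_⟩
    rintro rfl
    rcases hxy with ⟨-, h⟩ | ⟨-, h⟩ | ⟨h, rfl⟩
    · exact hT h
    · exact freshR_ne_freshS h.symm
    · exact hA h
  rcases ha with ha | ⟨v, hv, rfl⟩ | ⟨x, y, hxy, rfl⟩ | ⟨x, y, hxy, rfl⟩ | ⟨x, hx, rfl⟩
  · exact absurd ⟨a, ha, h⟩ hT
  · simp only [aA, List.mem_singleton] at h
    exact absurd (h ▸ hv) hA
  · simp only [aR, List.mem_cons, List.not_mem_nil, or_false] at h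
    exact absurd h (not_or.2 (hR hxy))
  · simp only [aS, List.mem_cons, List.not_mem_nil, or_false] at h
    rcases hxy with ⟨hx, hy⟩ | ⟨hx, rfl⟩ | ⟨w, hwx, rfl, -⟩
    · rcases h with rfl | rfl
      · exact absurd hx hT
      · exact absurd hy hT
    · exact absurd ((or_self_iff.1 h).symm ▸ hx) hA
    · rcases h with h | h
      · exact absurd h (hR hwx).2
      · obtain ⟨rfl, rfl⟩ := freshS_inj h
        rfl
  · simp only [aH, List.mem_cons, List.not_mem_nil, or_false] at h
    rcases h with rfl | h
    · exact absurd hx hA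
    · exact absurd h.symm freshLoop_ne_freshS

/-- The invariant of the terminating strategy: a loop `R(u,u)` on a new term is created only
after `S(u,u)`. -/
structure ChaseInv (F G : FactBase) : Prop where
  bound : ∀ a ∈ G, a ∈ chaseBound F
  loop : ∀ u ∉ F.terms, aR u u ∈ G → aS u u ∈ G

theorem ChaseInv.refl (F : FactBase) : ChaseInv F F :=
  ⟨fun _ ha => .inl ha, fun u hu h => absurd ⟨_, h, by simp [aR]⟩ hu⟩

theorem ChaseInv.freshS_mem {G : FactBase} (hG : ChaseInv F G) {π : Subst}
    (hon : Trigger.IsOn ⟨ruleS, π⟩ G) (hA : Applicable .R ⟨ruleS, π⟩ G)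
    (hy : π 1 ∈ aTerms F) : freshS (π 0) (π 1) ∈ aTerms F := by
  have hxy := isOn_ruleS.1 hon
  rcases RBound_of_aR (hG.bound _ hxy) with ⟨hx, hy⟩ | ⟨hx, hy'⟩ | ⟨hx, hy'⟩
  · exact .inr ⟨_, .inl hx, _, hy, rfl⟩
  · rw [hy'] at hy ⊢
    have := freshR_mem_aTerms hy
    exact .inr ⟨_, .inr this, _, this, rfl⟩
  · by_cases hT : π 0 ∈ F.terms
    · rw [hy']
      exact .inr ⟨_, .inl hT, _, hT, rfl⟩
    by_contra hZ
    have hout := out_ruleS π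
    rw [hy'] at hxy hZ hout
    have hnT : freshS (π 0) (π 0) ∉ F.terms := fun h => hZ (terms_subset_aTerms h)
    have hnocc : ∀ a ∈ G, freshS (π 0) (π 0) ∉ a.args := by
      intro a ha h
      have := freshS_occurs hT hnT (hG.bound a ha) h
      subst this
      exact not_applicable_of_out_subset (by rw [hout]; simpa using ha) hA
    obtain ⟨n, hn⟩ : ∃ n, freshS (π 0) (π 0) = .var n := ⟨_, rfl⟩
    rw [hn] at hnocc hout
    refine not_applicable_of_fresh hnocc hout (u := π 0) ?_ hA
    have : (aS (π 0) (.var n)).subst (fun v => if v = n then π 0 else .var v) =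
        aS (π 0) (π 0) := by
      simp [Atom.subst, aS, applyTerm_ite]
    rw [this]
    exact hG.loop _ hT hxy

theorem ChaseInv.union {G O : FactBase} (hG : ChaseInv F G) (hO : ∀ a ∈ O, a ∈ chaseBound F)
    (hloop : ∀ u ∉ F.terms, aR u u ∈ O → aS u u ∈ G) : ChaseInv F (G ∪ O) := by
  refine ⟨fun a ha => ?_, fun u hu h => Finset.mem_union_left _ ?_⟩
  · exact (Finset.mem_union.1 ha).elim (hG.bound a) (hO a)
  · exact (Finset.mem_union.1 h).elim (hG.loop u hu) (hloop u hu)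

theorem ChaseInv.step {G : FactBase} (hG : ChaseInv F G) {t : Trigger} (ht : t.rule ∈ R6set)
    (hon : t.IsOn G) (hA : Applicable .R t G)
    (hloop : t.rule = ruleLoop → aS (t.map 0) (t.map 0) ∈ G) : ChaseInv F (G ∪ t.out) := by
  obtain ⟨R, π⟩ := t
  rcases mem_R6set.1 ht with h | h | h | h | h <;> obtain rfl : R = _ := h
  · have hx := mem_aTerms_of_aA (hG.bound _ ((isOn_aA rfl).1 hon))
    rw [out_ruleLoop]
    refine hG.union (fun a ha => ?_) fun u _ hu => ?_
    · simp only [Finset.mem_insert, Finset.mem_singleton] at ha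
      rcases ha with rfl | rfl
      · exact .inr (.inr (.inl ⟨_, _, .inr (.inr ⟨hx, rfl⟩), rfl⟩))
      · exact .inr (.inr (.inr (.inr ⟨_, hx, rfl⟩)))
    · have : u = π 0 := by simpa [aR, aH] using hu
      rw [this]
      exact hloop rfl
  · have hx := (RBound_of_aR (hG.bound _ (isOn_ruleBack.1 hon).1)).left_mem
    rw [out_ruleBack]
    refine hG.union (fun a ha => ?_) fun u _ hu => ?_
    · rw [Finset.mem_singleton.1 ha]
      exact .inr (.inr (.inr (.inl ⟨_, _, .inr (.inl ⟨hx, rfl⟩), rfl⟩)))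
    · simp [aR, aS] at hu
  · have hx := mem_aTerms_of_aA (hG.bound _ (isOn_ruleProp.1 hon).1)
    have hy := (SBound_of_aS (hG.bound _ (isOn_ruleProp.1 hon).2)).right_mem hx
    rw [out_ruleProp]
    refine hG.union (fun a ha => ?_) fun u _ hu => ?_
    · rw [Finset.mem_singleton.1 ha]
      exact .inr (.inl ⟨_, hy, rfl⟩)
    · simp [aR, aA] at hu
  · have hx := mem_aTerms_of_aA (hG.bound _ ((isOn_aA rfl).1 hon))
    rw [out_ruleR]
    refine hG.union (fun a ha => ?_) fun u hu h => ?_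
    · rw [Finset.mem_singleton.1 ha]
      exact .inr (.inr (.inl ⟨_, _, .inr (.inl ⟨hx, rfl⟩), rfl⟩))
    · obtain ⟨h1, h2⟩ : u = π 0 ∧ u = freshR (π 0) := by simpa [aR] using h
      rw [← h1] at h2 hx
      rw [h2] at hx hu
      exact absurd (freshR_mem_aTerms hx) hu
  · have hxy := RBound_of_aR (hG.bound _ (isOn_ruleS.1 hon))
    have hz := hG.freshS_mem hon hA
    rw [out_ruleS]
    refine hG.union (fun a ha => ?_) fun u _ hu => ?_
    · rw [Finset.mem_singleton.1 ha]
      exact .inr (.inr (.inr (.inl ⟨_, _, .inr (.inr ⟨_, hxy, rfl, hz⟩), rfl⟩)))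
    · simp [aR, aS] at hu

theorem ruleLoop_not_isDatalog : ¬ ruleLoop.IsDatalog := by
  simp [Rule.IsDatalog, exVars_ruleLoop]

theorem ChaseInv.terminates {G : FactBase} (hG : ChaseInv F G) : Terminates R6set G := by
  induction hn : ((finite_chaseBound F).toFinset \ G).card using Nat.strong_induction_on
    generalizing G with
  | _ n ih =>
  subst hn
  have step {t : Trigger} (ht : t.rule ∈ R6set) (hon : t.IsOn G) (hA : Applicable .R t G)
      (hdf : ¬ t.rule.IsDatalog → ∀ R ∈ R6set, R.IsDatalog → SatisfiesRule ↑G R)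
      (hloop : t.rule = ruleLoop → aS (t.map 0) (t.map 0) ∈ G) : Terminates R6set G := by
    have hG' := hG.step ht hon hA hloop
    refine .of_step ht hon hA hdf (ih _ ?_ hG' rfl)
    obtain ⟨a, ha, haG⟩ := Finset.not_subset.1
      fun hs => not_applicable_of_out_subset hs hA
    refine Finset.card_lt_card ⟨Finset.sdiff_subset_sdiff le_rfl Finset.subset_union_left, ?_⟩
    intro hs
    have ha' : a ∈ G ∪ t.out := Finset.mem_union_right _ ha
    have := hs (Finset.mem_sdiff.2
      ⟨(finite_chaseBound F).mem_toFinset.2 (hG'.bound a ha'), haG⟩)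
    exact (Finset.mem_sdiff.1 this).2 ha'
  by_cases hdl : ∃ t : Trigger, t.rule ∈ R6set ∧ t.rule.IsDatalog ∧ t.IsOn G ∧
      Applicable .R t G
  · obtain ⟨t, ht, hd, hon, hA⟩ := hdl
    exact step ht hon hA (fun h => absurd hd h)
      fun h => absurd (h ▸ hd) ruleLoop_not_isDatalog
  have hdf : ∀ R ∈ R6set, R.IsDatalog → SatisfiesRule ↑G R := fun R hR hd =>
    satisfiesRule_of_not_applicable hd fun t ht hon hA =>
      hdl ⟨t, ht ▸ hR, ht ▸ hd, hon, hA⟩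
  by_cases hex : ∃ t : Trigger, t.rule ∈ R6set ∧ t.rule ≠ ruleLoop ∧ t.IsOn G ∧
      Applicable .R t G
  · obtain ⟨t, ht, hl, hon, hA⟩ := hex
    exact step ht hon hA (fun _ => hdf) fun h => absurd h hl
  have hsat (R : Rule) (hR : R ∈ R6set) (hl : R ≠ ruleLoop) : Saturated R G :=
    fun t ht hon hA => hex ⟨t, ht ▸ hR, ht ▸ hl, hon, hA⟩
  by_cases hlp : ∃ t : Trigger, t.rule ∈ R6set ∧ t.IsOn G ∧ Applicable .R t G
  · obtain ⟨t, ht, hon, hA⟩ := hlp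
    refine step ht hon hA (fun _ => hdf) fun h => ?_
    obtain ⟨R, π⟩ := t
    obtain rfl : R = _ := h
    obtain ⟨y, hy⟩ := (hsat ruleR (by simp [mem_R6set]) fun h => by
      have := congrArg (fun R => aH vx vy ∈ R.head) h
      simp [ruleR, ruleLoop, aR, aH] at this).exists_aR ((isOn_aA rfl).1 hon)
    obtain ⟨z, hz⟩ := (hsat ruleS (by simp [mem_R6set]) fun h => by
      have := congrArg Rule.body h
      simp [ruleS, ruleLoop, aR, aA] at this).exists_aS hy
    exact aS_of_satisfiesRule (hdf ruleBack (by simp [mem_R6set]) exVars_ruleBack) hy hz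
  · exact .of_not_applicable (fun t ht hon hA => hlp ⟨t, ht, hon, hA⟩) ⟨ruleR, Term.var⟩

end

/-! ### Nontermination for the single-piece decomposition -/

theorem Rule.sp_eq_self {R : Rule} {a : Atom} (h : R.head = {a}) : R.sp = {R} := by
  obtain ⟨B, H, hB, hH⟩ := R
  obtain rfl : H = {a} := h
  ext Q
  simp only [Rule.sp, Finset.mem_image, Finset.mem_attach, true_and, Finset.mem_singleton,
    Subtype.exists]
  have key : pieceOf ⟨B, {a}, hB, hH⟩ a = {a} := by
    ext b
    simp only [pieceOf, Finset.mem_filter, Finset.mem_singleton, and_iff_left_iff_imp]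
    rintro rfl
    exact .refl
  constructor
  · rintro ⟨b, rfl, rfl⟩
    simp [key]
  · rintro rfl
    exact ⟨a, rfl, by simp [key]⟩

theorem pieceAdj_ruleLoop {a b : Atom} (h : PieceAdj ruleLoop a b) : a = b := by
  obtain ⟨ha, hb, v, hv⟩ := h
  have hab := Finset.mem_inter.1 (Finset.mem_inter.1 hv).1
  have hv := (Finset.mem_inter.1 hv).2
  rw [exVars_ruleLoop, Finset.mem_singleton] at hv
  subst hv
  simp only [ruleLoop, Finset.mem_insert, Finset.mem_singleton] at ha hb
  rcases ha with rfl | rfl <;> rcases hb with rfl | rfl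
  · rfl
  · simpa [Atom.mem_vars, aR, vx] using hab.1
  · simpa [Atom.mem_vars, aR, vx] using hab.2
  · rfl

theorem pieceOf_ruleLoop {a : Atom} (ha : a ∈ ruleLoop.head) : pieceOf ruleLoop a = {a} := by
  ext b
  simp only [pieceOf, Finset.mem_filter, Finset.mem_singleton]
  constructor
  · rintro ⟨-, h⟩
    induction h with
    | refl => rfl
    | tail _ h ih => exact (pieceAdj_ruleLoop h).symm.trans ih
  · rintro rfl
    exact ⟨ha, .refl⟩

theorem mem_sp_ruleLoop {R : Rule} : R ∈ ruleLoop.sp ↔ R = ruleLoopR ∨ R = ruleLoopH := by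
  have hR : aR vx vx ∈ ruleLoop.head := by simp [ruleLoop]
  have hH : aH vx vy ∈ ruleLoop.head := by simp [ruleLoop]
  simp only [Rule.sp, Finset.mem_image, Finset.mem_attach, true_and, Subtype.exists]
  constructor
  · rintro ⟨a, ha, rfl⟩
    have ha' := ha
    simp only [ruleLoop, Finset.mem_insert, Finset.mem_singleton] at ha'
    rcases ha' with rfl | rfl
    · left; simp only [pieceOf_ruleLoop ha]; rfl
    · right; simp only [pieceOf_ruleLoop ha]; rfl
  · rintro (rfl | rfl)
    · exact ⟨_, hR, by simp only [pieceOf_ruleLoop hR]; rfl⟩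
    · exact ⟨_, hH, by simp only [pieceOf_ruleLoop hH]; rfl⟩

theorem mem_spSet_R6set {R : Rule} : R ∈ spSet R6set ↔ (R = ruleLoopR ∨ R = ruleLoopH) ∨
    R = ruleBack ∨ R = ruleProp ∨ R = ruleR ∨ R = ruleS := by
  simp only [spSet, Finset.mem_biUnion, mem_R6set, or_and_right, exists_or, exists_eq_left,
    mem_sp_ruleLoop]
  rw [Rule.sp_eq_self (R := ruleBack) rfl, Rule.sp_eq_self (R := ruleProp) rfl,
    Rule.sp_eq_self (R := ruleR) rfl, Rule.sp_eq_self (R := ruleS) rfl]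
  simp only [Finset.mem_singleton]

/-- The invariant of the Datalog-first chase of the decomposed rules: `A(x) → ∃y.R(x,y)` is never
applied, and the first successor of any `x` for `S` is a fresh variable. -/
structure SpInv (G : FactBase) : Prop where
  fresh : ∀ a ∈ G, ∀ x, freshR x ∉ a.args
  loop : ∀ x y, aR x y ∈ G → y = x
  succ : ∀ x y, aS x y ∈ G → aS x (freshS x x) ∈ G

theorem SpInv.not_applicable_ruleR {G : FactBase} (hG : SpInv G)
    (hloop : SatisfiesRule ↑G ruleLoopR) {π : Subst} (hon : Trigger.IsOn ⟨ruleR, π⟩ G) :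
    ¬ Applicable .R ⟨ruleR, π⟩ G := by
  intro hA
  have hx := (isOn_aA rfl).1 hon
  have hxx := aR_of_satisfiesRule hloop hx
  have hout := out_ruleR π
  obtain ⟨n, hn⟩ : ∃ n, freshR (π 0) = .var n := ⟨_, rfl⟩
  have hnocc : ∀ a ∈ G, Term.var n ∉ a.args := fun a ha => hn ▸ hG.fresh a ha (π 0)
  rw [hn] at hout
  refine not_applicable_of_fresh hnocc hout (u := π 0) ?_ hA
  have : (aR (π 0) (.var n)).subst (fun v => if v = n then π 0 else .var v) =
      aR (π 0) (π 0) := by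
    simp [Atom.subst, aR, applyTerm_ite]
  rw [this]
  exact hxx

theorem SpInv.insert {G : FactBase} (hG : SpInv G) {a : Atom} (hfresh : ∀ x, freshR x ∉ a.args)
    (hloop : ∀ x y, a = aR x y → y = x)
    (hsucc : ∀ x y, a = aS x y → aS x (freshS x x) ∈ G ∪ {a}) : SpInv (G ∪ {a}) := by
  refine ⟨fun b hb => ?_, fun x y h => ?_, fun x y h => ?_⟩
  · rcases Finset.mem_union.1 hb with hb | hb
    · exact hG.fresh b hb
    · exact Finset.mem_singleton.1 hb ▸ hfresh
  · rcases Finset.mem_union.1 h with h | h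
    · exact hG.loop x y h
    · exact hloop x y (Finset.mem_singleton.1 h).symm
  · rcases Finset.mem_union.1 h with h | h
    · exact Finset.mem_union_left _ (hG.succ x y h)
    · exact hsucc x y (Finset.mem_singleton.1 h).symm

theorem SpInv.step {G : FactBase} (hG : SpInv G) {t : Trigger} (ht : t.rule ∈ spSet R6set)
    (hon : t.IsOn G) (hA : Applicable .R t G)
    (hdf : ¬ t.rule.IsDatalog → SatisfiesRule ↑G ruleLoopR) : SpInv (G ∪ t.out) := by
  obtain ⟨R, π⟩ := t
  rcases mem_spSet_R6set.1 ht with (h | h) | h | h | h | h <;> obtain rfl : R = _ := h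
  · have hx := (isOn_aA rfl).1 hon
    rw [out_ruleLoopR]
    refine hG.insert (fun x => ?_) (fun x y h => ?_) fun x y h => ?_
    · simpa [aR, aA] using hG.fresh _ hx x
    · simp only [aR, Atom.mk.injEq, List.cons.injEq, and_true, true_and] at h
      exact h.2.symm.trans h.1
    · simp [aR, aS] at h
  · have hx := (isOn_aA rfl).1 hon
    rw [out_ruleLoopH]
    refine hG.insert (fun x => ?_) (fun x y h => ?_) fun x y h => ?_
    · simpa [aH, aA, freshR_ne_freshH] using hG.fresh _ hx x
    · simp [aR, aH] at h
    · simp [aH, aS] at h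
  · obtain ⟨hxy, hyz⟩ := isOn_ruleBack.1 hon
    rw [out_ruleBack]
    refine hG.insert (fun x => ?_) (fun x y h => ?_) fun x y h => ?_
    · have := hG.fresh _ hxy x
      simp [aR] at this
      simp [aS, this.1]
    · simp [aR, aS] at h
    · obtain ⟨rfl, rfl⟩ : π 0 = x ∧ π 0 = y := by simpa [aS] using h
      rw [hG.loop _ _ hxy] at hyz
      exact Finset.mem_union_left _ (hG.succ _ _ hyz)
  · obtain ⟨-, hxy⟩ := isOn_ruleProp.1 hon
    rw [out_ruleProp]
    refine hG.insert (fun x => ?_) (fun x y h => ?_) fun x y h => ?_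
    · have := hG.fresh _ hxy x
      simp [aS] at this
      simp [aA, this.2]
    · simp [aR, aA] at h
    · simp [aS, aA] at h
  · exact absurd hA (hG.not_applicable_ruleR
      (hdf (by simp [Rule.IsDatalog, exVars_ruleR])) hon)
  · have hxy := isOn_ruleS.1 hon
    have hy := hG.loop _ _ hxy
    rw [out_ruleS, hy]
    refine hG.insert (fun x => ?_) (fun x y h => ?_) fun x y h => ?_
    · have := hG.fresh _ hxy x
      simp [aR] at this
      simp [aS, this.1, freshR_ne_freshS]
    · simp [aR, aS] at h
    · obtain ⟨rfl, -⟩ : π 0 = x ∧ _ = y := by simpa [aS] using h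
      simp

theorem not_CTexDF_spSet_R6set : ¬ CTexDF .R (spSet R6set) := by
  intro h
  obtain ⟨D, hX, hdf, hF, hfin⟩ := h {aA (.const 0)}
  obtain ⟨n, hn⟩ := ENat.ne_top_iff_exists.1 hfin
  have hloopR : ruleLoopR ∈ spSet R6set := by simp [mem_spSet_R6set]
  have hinv : ∀ i ≤ n, SpInv (D.fb i) ∧ aA (.const 0) ∈ D.fb i := by
    intro i
    induction i with
    | zero =>
      intro _
      rw [D.fb_zero]
      refine ⟨⟨?_, ?_, ?_⟩, by simp⟩
      · simp [aA, freshR]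
      · simp [aA, aR]
      · simp [aA, aS]
    | succ i ih =>
      intro hi
      have hlt : (i : ℕ∞) < D.len := by rw [← hn]; exact_mod_cast hi
      obtain ⟨h1, h2⟩ := ih (by omega)
      rw [D.fb_succ i hlt]
      exact ⟨h1.step (D.rule_mem i hlt) (D.trig_on i hlt) (hX i hlt)
        fun h => hdf i hlt h _ hloopR exVars_ruleLoopR, Finset.mem_union_left _ h2⟩
  obtain ⟨hG, h0⟩ := hinv n le_rfl
  have hsat (R : Rule) (hR : R ∈ spSet R6set) : Saturated R (D.fb n) := by
    intro t ht hon hA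
    obtain ⟨j, hij, hj, -⟩ := hF n hn.le t (ht ▸ hR) hon hA
    rw [← hn] at hj
    have : j ≤ n := by exact_mod_cast hj
    omega
  have hsucc (x : Term) (hx : aA x ∈ D.fb n) : aA (freshS x x) ∈ D.fb n := by
    have hxx := aR_of_satisfiesRule
      (satisfiesRule_of_not_applicable exVars_ruleLoopR (hsat _ hloopR)) hx
    obtain ⟨z, hz⟩ := (hsat ruleS (by simp [mem_spSet_R6set])).exists_aS hxx
    exact aA_of_satisfiesRule (satisfiesRule_of_not_applicable exVars_ruleProp
      (hsat ruleProp (by simp [mem_spSet_R6set]))) hx (hG.succ _ _ hz)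
  have hfinite : {x | aA x ∈ D.fb n}.Finite :=
    (D.fb n).finite_toSet.preimage (f := aA) fun x _ y _ h => by simpa [aA] using h
  have := hfinite.to_subtype
  let f : {x | aA x ∈ D.fb n} → {x | aA x ∈ D.fb n} := fun x => ⟨freshS x x, hsucc x x.2⟩
  have hf : Function.Injective f := fun x y h =>
    Subtype.ext (freshS_inj (congrArg Subtype.val h)).1
  obtain ⟨x, hx⟩ := Finite.surjective_of_injective hf ⟨.const 0, h0⟩
  exact Term.noConfusion (congrArg Subtype.val hx)

/-- The single-piece decomposition does not preserve
sometimes-termination of the Datalog-first restricted chase. -/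
theorem statement6 : CTexDF Variant.R R6set ∧ ¬ CTexDF Variant.R (spSet R6set) :=
  ⟨fun F => (ChaseInv.refl F).terminates, not_CTexDF_spSet_R6set⟩

end
end ExRules
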